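/- arXiv:1508.02824 — 3 statements merged into one kernel-verified Lean document; each statement's English description precedes it below -/
import Mathlib

section
/- Let X have the Weibull distribution with shape a > 0 and scale b > 0, and let ℓ(x|a, b) = log f(x|a, b) be the log-density. Then the Fisher information matrix with respect to the parameters (a, b), given by the negative expected Hessian of ℓ, equals the 2×2 matrix with entries I₁₁ = (1/a²)(ψ′(1) + ψ(2)²), I₁₂ = I₂₁ = −(1/b)(1 + ψ(1)), and I₂₂ = a²/b², where ψ is the digamma function and ψ′ the trigamma function. -/
open MeasureTheory Set

/-- Density of the Weibull distribution with shape `a` and scale `b`. -/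
noncomputable def weibullPDF (a b x : ℝ) : ℝ :=
  if 0 < x then (a / b) * (x / b) ^ (a - 1) * Real.exp (-(x / b) ^ a) else 0

/-- The digamma function `ψ(x) = Γ′(x)/Γ(x)`. -/
noncomputable def digamma (x : ℝ) : ℝ := deriv Real.Gamma x / Real.Gamma x

/-- The trigamma function `ψ′(x)`, the derivative of the digamma function. -/
noncomputable def trigamma (x : ℝ) : ℝ := deriv digamma x

open Filter Topology Asymptotics

/-- The `k`-th logarithmic moment `∫ t ^ (s - 1) (log t) ^ k e ^ (-t) dt` on `(0, ∞)`, which is the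
`k`-th derivative of the Gamma function at `s`. -/
noncomputable def gammaLogMoment (k : ℕ) (s : ℝ) : ℝ :=
  ∫ t in Ioi (0 : ℝ), t ^ (s - 1) * (Real.log t ^ k * Real.exp (-t))

theorem continuousOn_log_pow_mul_exp_neg (k : ℕ) :
    ContinuousOn (fun t : ℝ => ((Real.log t ^ k * Real.exp (-t) : ℝ) : ℂ)) (Ioi 0) := by
  refine Complex.continuous_ofReal.comp_continuousOn (ContinuousOn.mul ?_ (by fun_prop))
  exact (Real.continuousOn_log.mono fun x hx => (ne_of_gt hx)).pow k

theorem isBigO_log_pow_mul_exp_neg_atTop (k : ℕ) (c : ℝ) :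
    (fun t : ℝ => ((Real.log t ^ k * Real.exp (-t) : ℝ) : ℂ)) =O[atTop] (· ^ (-c) : ℝ → ℝ) := by
  rw [← isBigO_norm_left]
  simp only [Complex.norm_real, isBigO_norm_left]
  have h1 : (fun x : ℝ => Real.log x ^ k) =O[atTop] id := Real.isLittleO_pow_log_id_atTop.isBigO
  have h2 : (fun x : ℝ => Real.exp (-x)) =O[atTop] (fun x : ℝ => x ^ (-c - 1)) := by
    simpa using (isLittleO_exp_neg_mul_rpow_atTop one_pos (-c - 1)).isBigO
  refine (h1.mul h2).congr' .rfl ?_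
  filter_upwards [eventually_gt_atTop 0] with x hx
  rw [Real.rpow_sub_one hx.ne', id, mul_div_cancel₀ _ hx.ne']

theorem isBigO_log_pow_mul_exp_neg_nhdsGT_zero (k : ℕ) {c : ℝ} (hc : 0 < c) :
    (fun t : ℝ => ((Real.log t ^ k * Real.exp (-t) : ℝ) : ℂ)) =O[𝓝[>] 0]
      (· ^ (-c) : ℝ → ℝ) := by
  rw [← isBigO_norm_left]
  simp only [Complex.norm_real, isBigO_norm_left]
  have h1 : (fun x : ℝ => Real.log x ^ k) =O[𝓝[>] 0] (fun x : ℝ => x ^ (-c)) := by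
    have := (isLittleO_abs_log_rpow_rpow_nhdsGT_zero k (neg_neg_of_pos hc)).isBigO
    simp only [Real.rpow_natCast, ← abs_pow] at this
    exact this.of_abs_left
  have h2 : (fun x : ℝ => Real.exp (-x)) =O[𝓝[>] 0] (fun _ : ℝ => (1 : ℝ)) := by
    refine IsBigO.of_bound 1 ?_
    filter_upwards [self_mem_nhdsWithin] with x hx
    simpa [abs_of_pos (Real.exp_pos _)] using (le_of_lt hx)
  simpa using h1.mul h2

theorem mellin_log_pow_mul_exp_neg (k : ℕ) (s : ℝ) :
    mellin (fun t : ℝ => ((Real.log t ^ k * Real.exp (-t) : ℝ) : ℂ)) s = gammaLogMoment k s := by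
  rw [mellin, gammaLogMoment, ← integral_complex_ofReal]
  refine setIntegral_congr_fun measurableSet_Ioi fun t ht => ?_
  simp only [smul_eq_mul]
  rw [Complex.ofReal_mul (t ^ (s - 1)), Complex.ofReal_cpow (le_of_lt ht)]
  push_cast
  rfl

theorem integrableOn_gammaLogMoment (k : ℕ) {s : ℝ} (hs : 0 < s) :
    IntegrableOn (fun t : ℝ => t ^ (s - 1) * (Real.log t ^ k * Real.exp (-t))) (Ioi 0) := by
  have h : MellinConvergent (fun t : ℝ => ((Real.log t ^ k * Real.exp (-t) : ℝ) : ℂ)) s :=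
    mellinConvergent_of_isBigO_rpow
      ((continuousOn_log_pow_mul_exp_neg k).locallyIntegrableOn measurableSet_Ioi)
      (isBigO_log_pow_mul_exp_neg_atTop k (s + 1)) (by simp)
      (isBigO_log_pow_mul_exp_neg_nhdsGT_zero k (half_pos hs)) (by simpa using hs)
  refine IntegrableOn.congr_fun (f := fun t : ℝ => RCLike.re ((t : ℂ) ^ ((s : ℂ) - 1) •
    ((Real.log t ^ k * Real.exp (-t) : ℝ) : ℂ))) (Integrable.re h) (fun t ht => ?_)
    measurableSet_Ioi
  have : (t : ℂ) ^ ((s : ℂ) - 1) = ((t ^ (s - 1) : ℝ) : ℂ) := by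
    rw [Complex.ofReal_cpow (le_of_lt ht)]
    push_cast
    rfl
  simp only [this, smul_eq_mul, ← Complex.ofReal_mul]
  exact Complex.ofReal_re _

theorem hasDerivAt_gammaLogMoment (k : ℕ) {s : ℝ} (hs : 0 < s) :
    HasDerivAt (gammaLogMoment k) (gammaLogMoment (k + 1) s) s := by
  have h := (mellin_hasDerivAt_of_isBigO_rpow (s := (s : ℂ))
    ((continuousOn_log_pow_mul_exp_neg k).locallyIntegrableOn measurableSet_Ioi)
    (isBigO_log_pow_mul_exp_neg_atTop k (s + 1)) (by simp)
    (isBigO_log_pow_mul_exp_neg_nhdsGT_zero k (half_pos hs)) (by simpa using hs)).2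
  have e : (fun t : ℝ => Real.log t • ((Real.log t ^ k * Real.exp (-t) : ℝ) : ℂ)) =
      fun t : ℝ => ((Real.log t ^ (k + 1) * Real.exp (-t) : ℝ) : ℂ) := by
    funext t
    rw [Complex.real_smul, ← Complex.ofReal_mul, pow_succ', mul_assoc]
  rw [e] at h
  simpa only [mellin_log_pow_mul_exp_neg, Complex.ofReal_re] using h.real_of_complex

theorem gammaLogMoment_zero {s : ℝ} (hs : 0 < s) : gammaLogMoment 0 s = Real.Gamma s := by
  rw [Real.Gamma_eq_integral hs, gammaLogMoment]
  simp [mul_comm]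

theorem hasDerivAt_Gamma_gammaLogMoment {s : ℝ} (hs : 0 < s) :
    HasDerivAt Real.Gamma (gammaLogMoment 1 s) s :=
  (hasDerivAt_gammaLogMoment 0 hs).congr_of_eventuallyEq <| by
    filter_upwards [lt_mem_nhds hs] with x hx using (gammaLogMoment_zero hx).symm

theorem gammaLogMoment_one_add_one {s : ℝ} (hs : 0 < s) :
    gammaLogMoment 1 (s + 1) = Real.Gamma s + s * gammaLogMoment 1 s := by
  have h1 := (hasDerivAt_Gamma_gammaLogMoment (add_pos hs one_pos)).comp_add_const s 1
  have h2 := (hasDerivAt_id s).mul (hasDerivAt_Gamma_gammaLogMoment hs)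
  have h3 := h1.unique (h2.congr_of_eventuallyEq (by
    filter_upwards [lt_mem_nhds hs] with x hx using Real.Gamma_add_one hx.ne'))
  simpa using h3

theorem gammaLogMoment_two_add_one {s : ℝ} (hs : 0 < s) :
    gammaLogMoment 2 (s + 1) = 2 * gammaLogMoment 1 s + s * gammaLogMoment 2 s := by
  have h1 := (hasDerivAt_gammaLogMoment 1 (add_pos hs one_pos)).comp_add_const s 1
  have h2 := (hasDerivAt_Gamma_gammaLogMoment hs).add
    ((hasDerivAt_id s).mul (hasDerivAt_gammaLogMoment 1 hs))
  have h3 := h1.unique (h2.congr_of_eventuallyEq (by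
    filter_upwards [lt_mem_nhds hs] with x hx using gammaLogMoment_one_add_one hx))
  simp only [id, one_mul, Nat.reduceAdd] at h3
  linarith

theorem digamma_eq_gammaLogMoment {s : ℝ} (hs : 0 < s) :
    digamma s = gammaLogMoment 1 s / Real.Gamma s := by
  rw [digamma, (hasDerivAt_Gamma_gammaLogMoment hs).deriv]

theorem digamma_one_eq_gammaLogMoment : digamma 1 = gammaLogMoment 1 1 := by
  rw [digamma_eq_gammaLogMoment one_pos, Real.Gamma_one, div_one]

theorem digamma_two_eq_gammaLogMoment : digamma 2 = gammaLogMoment 1 2 := by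
  rw [digamma_eq_gammaLogMoment two_pos, Real.Gamma_two, div_one]

theorem trigamma_one_eq_gammaLogMoment :
    trigamma 1 = gammaLogMoment 2 1 - gammaLogMoment 1 1 ^ 2 := by
  have h := (hasDerivAt_gammaLogMoment 1 one_pos).div (hasDerivAt_Gamma_gammaLogMoment one_pos)
    (by simp)
  have h' := h.congr_of_eventuallyEq (f₁ := digamma) (by
    filter_upwards [lt_mem_nhds one_pos] with x hx using digamma_eq_gammaLogMoment hx)
  rw [trigamma, h'.deriv, Real.Gamma_one]
  ring

theorem gammaLogMoment_two_eq (k : ℕ) :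
    gammaLogMoment k 2 = ∫ t in Ioi (0 : ℝ), t * Real.log t ^ k * Real.exp (-t) := by
  rw [gammaLogMoment]
  norm_num [mul_assoc]

theorem integrableOn_mul_log_pow_mul_exp_neg (k : ℕ) :
    IntegrableOn (fun t : ℝ => t * Real.log t ^ k * Real.exp (-t)) (Ioi 0) := by
  refine (integrableOn_gammaLogMoment k two_pos).congr_fun (fun t _ => ?_) measurableSet_Ioi
  norm_num [mul_assoc]

theorem setIntegral_mul_exp_neg_linear_combination (p q r v : ℝ) :
    ∫ t in Ioi (0 : ℝ),
        (p + q * t + r * (t * Real.log t) + v * (t * Real.log t ^ 2)) * Real.exp (-t) =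
      p + q + r * gammaLogMoment 1 2 + v * gammaLogMoment 2 2 := by
  have h0 := integrableOn_mul_log_pow_mul_exp_neg 0
  have h1 := integrableOn_mul_log_pow_mul_exp_neg 1
  have h2 := integrableOn_mul_log_pow_mul_exp_neg 2
  have he : IntegrableOn (fun t : ℝ => Real.exp (-t)) (Ioi 0) := integrableOn_exp_neg_Ioi 0
  have m0 : ∫ t in Ioi (0 : ℝ), t * Real.log t ^ 0 * Real.exp (-t) = 1 := by
    rw [← gammaLogMoment_two_eq, gammaLogMoment_zero two_pos, Real.Gamma_two]
  have e : ∀ t : ℝ,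
      (p + q * t + r * (t * Real.log t) + v * (t * Real.log t ^ 2)) * Real.exp (-t) =
      p * Real.exp (-t) + q * (t * Real.log t ^ 0 * Real.exp (-t)) +
        r * (t * Real.log t ^ 1 * Real.exp (-t)) +
        v * (t * Real.log t ^ 2 * Real.exp (-t)) := fun t => by ring
  simp_rw [e]
  have i1 := (he.const_mul p).fun_add (h0.const_mul q)
  rw [integral_add (i1.fun_add (h1.const_mul r)) (h2.const_mul v),
    integral_add i1 (h1.const_mul r), integral_add (he.const_mul p) (h0.const_mul q)]
  simp only [integral_const_mul]
  rw [m0, ← gammaLogMoment_two_eq, ← gammaLogMoment_two_eq, integral_exp_neg_Ioi_zero]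
  ring

theorem setIntegral_comp_mul_weibullPDF {a b : ℝ} (ha : 0 < a) (hb : 0 < b) (g : ℝ → ℝ) :
    ∫ x in Ioi (0 : ℝ), g ((x / b) ^ a) * weibullPDF a b x =
      ∫ t in Ioi (0 : ℝ), g t * Real.exp (-t) := by
  rw [← integral_comp_rpow_Ioi_of_pos (g := fun t => g t * Real.exp (-t)) ha]
  have h := integral_comp_mul_right_Ioi'
    (fun u : ℝ => (a * u ^ (a - 1)) • (g (u ^ a) * Real.exp (-u ^ a))) 0 (inv_pos.mpr hb)
  rw [zero_mul] at h
  rw [← h, smul_eq_mul, ← integral_const_mul]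
  refine setIntegral_congr_fun measurableSet_Ioi fun x hx => ?_
  simp only [weibullPDF, if_pos (mem_Ioi.mp hx), smul_eq_mul, div_eq_mul_inv]
  ring

theorem log_weibullPDF {a b x : ℝ} (ha : 0 < a) (hb : 0 < b) (hx : 0 < x) :
    Real.log (weibullPDF a b x) =
      Real.log a - Real.log b + (a - 1) * (Real.log x - Real.log b) - (x / b) ^ a := by
  have h := Real.rpow_pos_of_pos (div_pos hx hb) (a - 1)
  rw [weibullPDF, if_pos hx, Real.log_mul (by positivity) (Real.exp_ne_zero _),
    Real.log_mul (by positivity) h.ne', Real.log_exp, Real.log_rpow (by positivity),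
    Real.log_div ha.ne' hb.ne', Real.log_div hx.ne' hb.ne']
  ring

theorem hasDerivAt_log_weibullPDF_shape {a b x : ℝ} (ha : 0 < a) (hb : 0 < b) (hx : 0 < x) :
    HasDerivAt (fun a' => Real.log (weibullPDF a' b x))
      (a⁻¹ + (Real.log x - Real.log b) - (x / b) ^ a * Real.log (x / b)) a := by
  have h := ((((Real.hasDerivAt_log ha.ne').sub_const (Real.log b)).add
    (((hasDerivAt_id a).sub_const 1).mul_const (Real.log x - Real.log b))).sub
    (Real.hasStrictDerivAt_const_rpow (div_pos hx hb) a).hasDerivAt)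
  rw [one_mul] at h
  refine h.congr_of_eventuallyEq ?_
  filter_upwards [lt_mem_nhds ha] with a' ha' using log_weibullPDF ha' hb hx

theorem hasDerivAt_div_rpow_scale (a : ℝ) {b x : ℝ} (hb : 0 < b) (hx : 0 < x) :
    HasDerivAt (fun b' => (x / b') ^ a) (-(a / b) * (x / b) ^ a) b := by
  have h := ((hasDerivAt_inv hb.ne').const_mul x).rpow_const (p := a)
    (Or.inl (by positivity))
  simp only [← div_eq_mul_inv] at h
  refine h.congr_deriv ?_
  rw [Real.rpow_sub_one (by positivity)]
  field_simp

theorem hasDerivAt_log_weibullPDF_scale {a b x : ℝ} (ha : 0 < a) (hb : 0 < b) (hx : 0 < x) :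
    HasDerivAt (fun b' => Real.log (weibullPDF a b' x)) (a * b⁻¹ * ((x / b) ^ a - 1)) b := by
  have hl := Real.hasDerivAt_log hb.ne'
  have h := (((hl.const_sub (Real.log a)).add
    ((hl.const_sub (Real.log x)).const_mul (a - 1))).sub (hasDerivAt_div_rpow_scale a hb hx))
  refine (h.congr_of_eventuallyEq ?_).congr_deriv ?_
  · filter_upwards [lt_mem_nhds hb] with b' hb' using log_weibullPDF ha hb' hx
  · ring

theorem iteratedDeriv_two_log_weibullPDF_shape {a b x : ℝ} (ha : 0 < a) (hb : 0 < b)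
    (hx : 0 < x) :
    iteratedDeriv 2 (fun a' => Real.log (weibullPDF a' b x)) a =
      -(a ^ 2)⁻¹ - (x / b) ^ a * Real.log (x / b) ^ 2 := by
  rw [iteratedDeriv_succ, iteratedDeriv_one]
  have h := ((hasDerivAt_inv ha.ne').add_const (Real.log x - Real.log b)).sub
    ((Real.hasStrictDerivAt_const_rpow (div_pos hx hb) a).hasDerivAt.mul_const (Real.log (x / b)))
  rw [(h.congr_of_eventuallyEq ?_).deriv]
  · ring
  · filter_upwards [lt_mem_nhds ha] with a' ha' using
      (hasDerivAt_log_weibullPDF_shape ha' hb hx).deriv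

theorem deriv_deriv_log_weibullPDF {a b x : ℝ} (ha : 0 < a) (hb : 0 < b) (hx : 0 < x) :
    deriv (fun a' => deriv (fun b' => Real.log (weibullPDF a' b' x)) b) a =
      b⁻¹ * ((x / b) ^ a - 1) + a * b⁻¹ * ((x / b) ^ a * Real.log (x / b)) := by
  have h := ((hasDerivAt_id a).mul_const b⁻¹).mul
    ((Real.hasStrictDerivAt_const_rpow (div_pos hx hb) a).hasDerivAt.sub_const 1)
  rw [one_mul] at h
  refine (h.congr_of_eventuallyEq ?_).deriv
  filter_upwards [lt_mem_nhds ha] with a' ha' using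
    (hasDerivAt_log_weibullPDF_scale ha' hb hx).deriv

theorem iteratedDeriv_two_log_weibullPDF_scale {a b x : ℝ} (ha : 0 < a) (hb : 0 < b)
    (hx : 0 < x) :
    iteratedDeriv 2 (fun b' => Real.log (weibullPDF a b' x)) b =
      a / b ^ 2 - a * (a + 1) / b ^ 2 * (x / b) ^ a := by
  rw [iteratedDeriv_succ, iteratedDeriv_one]
  have h := ((hasDerivAt_inv hb.ne').const_mul a).mul
    ((hasDerivAt_div_rpow_scale a hb hx).sub_const 1)
  rw [(h.congr_of_eventuallyEq ?_).deriv]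
  · field_simp
    ring
  · filter_upwards [lt_mem_nhds hb] with b' hb' using
      (hasDerivAt_log_weibullPDF_scale ha hb' hx).deriv

theorem setIntegral_mul_weibullPDF_eq {a b : ℝ} (ha : 0 < a) (hb : 0 < b) {h : ℝ → ℝ}
    (p q r v : ℝ)
    (hh : ∀ x, 0 < x → h x = p + q * (x / b) ^ a + r * ((x / b) ^ a * (a * Real.log (x / b))) +
      v * ((x / b) ^ a * (a * Real.log (x / b)) ^ 2)) :
    ∫ x in Ioi (0 : ℝ), h x * weibullPDF a b x =
      p + q + r * gammaLogMoment 1 2 + v * gammaLogMoment 2 2 := by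
  rw [← setIntegral_mul_exp_neg_linear_combination, ← setIntegral_comp_mul_weibullPDF ha hb
    (fun t => p + q * t + r * (t * Real.log t) + v * (t * Real.log t ^ 2))]
  refine setIntegral_congr_fun measurableSet_Ioi fun x hx => ?_
  simp only [hh x hx, Real.log_rpow (div_pos hx hb)]

/-- The Fisher information matrix of the Weibull distribution with parameters `(a, b)`,
computed as the negative expected Hessian of the log-density, has entries
`I₁₁ = (1/a²)(ψ′(1) + ψ(2)²)`, `I₁₂ = I₂₁ = −(1/b)(1 + ψ(1))`, `I₂₂ = a²/b²`. -/
theorem weibull_fisher_information (a b : ℝ) (ha : 0 < a) (hb : 0 < b) :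
    (-∫ x in Set.Ioi (0 : ℝ),
        iteratedDeriv 2 (fun a' => Real.log (weibullPDF a' b x)) a * weibullPDF a b x
      = (1 / a ^ 2) * (trigamma 1 + digamma 2 ^ 2)) ∧
    (-∫ x in Set.Ioi (0 : ℝ),
        deriv (fun a' => deriv (fun b' => Real.log (weibullPDF a' b' x)) b) a * weibullPDF a b x
      = -(1 / b) * (1 + digamma 1)) ∧
    (-∫ x in Set.Ioi (0 : ℝ),
        iteratedDeriv 2 (fun b' => Real.log (weibullPDF a b' x)) b * weibullPDF a b x
      = a ^ 2 / b ^ 2) := by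
  have hm1 : gammaLogMoment 1 2 = 1 + gammaLogMoment 1 1 := by
    simpa [one_add_one_eq_two] using gammaLogMoment_one_add_one one_pos
  have hm2 : gammaLogMoment 2 2 = 2 * gammaLogMoment 1 1 + gammaLogMoment 2 1 := by
    simpa [one_add_one_eq_two] using gammaLogMoment_two_add_one one_pos
  refine ⟨?_, ?_, ?_⟩
  · rw [setIntegral_mul_weibullPDF_eq ha hb (-(a ^ 2)⁻¹) 0 0 (-(a ^ 2)⁻¹), hm2,
      trigamma_one_eq_gammaLogMoment, digamma_two_eq_gammaLogMoment, hm1]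
    · ring
    · intro x hx
      rw [iteratedDeriv_two_log_weibullPDF_shape ha hb hx]
      field_simp
      ring
  · rw [setIntegral_mul_weibullPDF_eq ha hb (-b⁻¹) b⁻¹ b⁻¹ 0, hm1,
      digamma_one_eq_gammaLogMoment]
    · ring
    · intro x hx
      rw [deriv_deriv_log_weibullPDF ha hb hx]
      ring
  · rw [setIntegral_mul_weibullPDF_eq ha hb (a / b ^ 2) (-(a * (a + 1) / b ^ 2)) 0 0]
    · ring
    · intro x hx
      rw [iteratedDeriv_two_log_weibullPDF_scale ha hb hx]
      ring
end

section
/- Let X have the log-logistic distribution LL(a, s) with a > 0 and s > 0, and let ℓ(x|a, s) = log f(x|a, s) be the log-density. Then the Fisher information matrix with respect to the parameters (a, s), given by the negative expected Hessian of ℓ, is the diagonal matrix with entries I₁₁ = (3 + π²)/(9a²), I₂₂ = (1/3)(a/s)², and I₁₂ = I₂₁ = 0. In particular this matrix is positive definite. -/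
open MeasureTheory Set

/-- Density of the log-logistic distribution `LL(a, s)`. -/
noncomputable def llogisPDF (a s x : ℝ) : ℝ :=
  if 0 < x then a * (x / s) ^ a / (x * (1 + (x / s) ^ a) ^ 2) else 0

section

open Real Filter Topology

theorem hasSum_alternating_one_div_succ_sq :
    HasSum (fun n : ℕ => (-1 : ℝ) ^ n / ((n : ℝ) + 1) ^ 2) (π ^ 2 / 12) := by
  have hzeta : HasSum (fun n : ℕ => (1 : ℝ) / ((n : ℝ) + 1) ^ 2) (π ^ 2 / 6) := by
    simpa using (hasSum_nat_add_iff' 1).mpr hasSum_zeta_two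
  have hodd : HasSum (fun k : ℕ => (1 : ℝ) / (((2 * k + 1 : ℕ) : ℝ) + 1) ^ 2)
      (1 / 4 * (π ^ 2 / 6)) := by
    refine (hzeta.mul_left (1 / 4)).congr_fun fun k => ?_
    push_cast
    field_simp
    ring
  have heven : Summable (fun k : ℕ => (1 : ℝ) / (((2 * k : ℕ) : ℝ) + 1) ^ 2) :=
    hzeta.summable.comp_injective (mul_right_injective₀ (two_ne_zero' ℕ))
  obtain ⟨v, heven⟩ := heven
  have hv := (HasSum.even_add_odd (f := fun n : ℕ => (1 : ℝ) / ((n : ℝ) + 1) ^ 2)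
    heven hodd).unique hzeta
  have h := HasSum.even_add_odd (f := fun n : ℕ => (-1 : ℝ) ^ n / ((n : ℝ) + 1) ^ 2)
    (heven.congr_fun fun k => by rw [pow_mul, neg_one_sq, one_pow])
    (hodd.neg.congr_fun fun k => by rw [pow_succ, pow_mul, neg_one_sq, one_pow]; ring)
  convert h using 1
  linarith

namespace Real

theorem one_sub_sigmoid_le_exp_neg (t : ℝ) : 1 - sigmoid t ≤ exp (-t) := by
  rw [← sigmoid_neg, ← sigmoid_mul_rexp_neg]
  exact mul_le_of_le_one_left (exp_pos _).le (sigmoid_le_one t)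

theorem hasSum_one_sub_sigmoid {t : ℝ} (ht : 0 < t) :
    HasSum (fun n : ℕ => (-1 : ℝ) ^ n * exp (-((n : ℝ) + 1) * t)) (1 - sigmoid t) := by
  have h : |(-exp (-t))| < 1 := by
    rw [abs_neg, abs_of_pos (exp_pos _)]
    exact exp_lt_one_iff.mpr (by linarith)
  have hsum : exp (-t) * (1 - -exp (-t))⁻¹ = 1 - sigmoid t := by
    rw [← sigmoid_neg, ← sigmoid_mul_rexp_neg, sigmoid_def, sub_neg_eq_add, mul_comm]
  rw [← hsum]
  refine ((hasSum_geometric_of_abs_lt_one h).mul_left (exp (-t))).congr_fun fun n => ?_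
  rw [neg_pow (exp _), ← exp_nat_mul, mul_left_comm, ← exp_add]
  ring_nf

theorem integrableOn_mul_one_sub_sigmoid :
    IntegrableOn (fun t => t * (1 - sigmoid t)) (Ioi 0) := by
  have h : IntegrableOn (fun t : ℝ => exp (-t) * t) (Ioi 0) := by
    have := GammaIntegral_convergent (s := 2) two_pos
    norm_num at this
    exact this
  refine h.mono' ?_ ?_
  · exact Continuous.aestronglyMeasurable (by fun_prop)
  · filter_upwards [ae_restrict_mem measurableSet_Ioi] with t ht
    have ht : 0 < t := ht
    have h1 := sigmoid_le_one t
    rw [norm_of_nonneg (mul_nonneg ht.le (by linarith)), mul_comm]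
    exact mul_le_mul_of_nonneg_right (one_sub_sigmoid_le_exp_neg t) ht.le

theorem integral_mul_one_sub_sigmoid :
    ∫ t in Ioi (0 : ℝ), t * (1 - sigmoid t) = π ^ 2 / 12 := by
  have key := hasSum_mellin (a := fun n : ℕ => (-1 : ℂ) ^ n) (p := fun n : ℕ => (n : ℝ) + 1)
    (F := fun t => ((1 - sigmoid t : ℝ) : ℂ)) (s := 2) (fun n => Or.inr (by positivity))
    (by norm_num) (fun t ht => by
      have := Complex.hasSum_ofReal.mpr (hasSum_one_sub_sigmoid ht)
      convert this using 2 with n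
      push_cast
      rfl)
    (by
      have := (summable_nat_add_iff 1).mpr (summable_one_div_nat_pow.mpr one_lt_two)
      simpa using this)
  have hm : mellin (fun t => ((1 - sigmoid t : ℝ) : ℂ)) 2
      = ((∫ t in Ioi (0 : ℝ), t * (1 - sigmoid t) : ℝ) : ℂ) := by
    rw [mellin, ← integral_complex_ofReal]
    refine setIntegral_congr_fun measurableSet_Ioi fun t _ => ?_
    norm_num
  rw [hm] at key
  have hG : Complex.Gamma 2 = 1 := by
    simp [Complex.Gamma_ofNat_eq_factorial]
  have h2 := Complex.hasSum_ofReal.mpr hasSum_alternating_one_div_succ_sq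
  refine Complex.ofReal_injective (key.unique ?_)
  convert h2 using 2 with n
  rw [hG]
  push_cast
  rw [one_mul]
  norm_cast

theorem sigmoid_mul_one_sub_nonneg (t : ℝ) : 0 ≤ sigmoid t * (1 - sigmoid t) :=
  mul_nonneg (sigmoid_nonneg t) (sub_nonneg.mpr (sigmoid_le_one t))

theorem sigmoid_abs_mul_one_sub (t : ℝ) :
    sigmoid |t| * (1 - sigmoid |t|) = sigmoid t * (1 - sigmoid t) := by
  rcases abs_choice t with h | h <;> rw [h]
  rw [sigmoid_neg]
  ring

theorem integral_sigmoid_mul_one_sub : ∫ t, sigmoid t * (1 - sigmoid t) = 1 := by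
  have h := integral_comp_abs (f := fun t => sigmoid t * (1 - sigmoid t))
  simp only [sigmoid_abs_mul_one_sub] at h
  rw [h, integral_Ioi_of_hasDerivAt_of_nonneg' (fun x _ => hasDerivAt_sigmoid x)
    (fun x _ => sigmoid_mul_one_sub_nonneg x) tendsto_sigmoid_atTop, sigmoid_zero]
  norm_num

theorem integral_sq_sigmoid_mul_one_sub :
    ∫ t, (sigmoid t * (1 - sigmoid t)) ^ 2 = 1 / 6 := by
  have h := integral_comp_abs (f := fun t => (sigmoid t * (1 - sigmoid t)) ^ 2)
  simp only [sigmoid_abs_mul_one_sub] at h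
  have hd (x : ℝ) : HasDerivAt (fun t => sigmoid t ^ 2 / 2 - sigmoid t ^ 3 / 3)
      ((sigmoid x * (1 - sigmoid x)) ^ 2) x := by
    have hs := hasDerivAt_sigmoid x
    refine (((hs.fun_pow 2).div_const 2).sub ((hs.fun_pow 3).div_const 3)).congr_deriv ?_
    norm_num
    ring
  rw [h, integral_Ioi_of_hasDerivAt_of_nonneg' (fun x _ => hd x) (fun x _ => sq_nonneg _)
    (((tendsto_sigmoid_atTop.pow 2).div_const 2).sub ((tendsto_sigmoid_atTop.pow 3).div_const 3)),
    sigmoid_zero]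
  norm_num

theorem mul_one_sub_sigmoid_le_one (t : ℝ) : t * (1 - sigmoid t) ≤ 1 := by
  rcases le_total t 0 with ht | ht
  · nlinarith [sigmoid_le_one t]
  · calc t * (1 - sigmoid t) ≤ t * exp (-t) := by
          gcongr
          exact one_sub_sigmoid_le_exp_neg t
      _ ≤ exp t * exp (-t) := by
          gcongr
          linarith [add_one_le_exp t]
      _ = 1 := by rw [← exp_add]; simp

theorem tendsto_pow_mul_one_sub_sigmoid_atTop (n : ℕ) :
    Tendsto (fun t => t ^ n * (1 - sigmoid t)) atTop (𝓝 0) := by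
  refine squeeze_zero' ?_ ?_ (tendsto_pow_mul_exp_neg_atTop_nhds_zero n)
  · filter_upwards [eventually_ge_atTop 0] with t ht
    exact mul_nonneg (pow_nonneg ht n) (sub_nonneg.mpr (sigmoid_le_one t))
  · filter_upwards [eventually_ge_atTop 0] with t ht
    gcongr
    exact one_sub_sigmoid_le_exp_neg t

theorem integrableOn_sq_mul_sq_sigmoid_mul_one_sub :
    IntegrableOn (fun t => (t * (sigmoid t * (1 - sigmoid t))) ^ 2) (Ioi 0) := by
  refine integrableOn_mul_one_sub_sigmoid.mono' ?_ ?_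
  · exact Continuous.aestronglyMeasurable (by fun_prop)
  · filter_upwards [ae_restrict_mem measurableSet_Ioi] with t ht
    have h0 : 0 ≤ t * (1 - sigmoid t) :=
      mul_nonneg (le_of_lt ht) (sub_nonneg.mpr (sigmoid_le_one t))
    rw [norm_of_nonneg (sq_nonneg _), mul_left_comm, mul_pow]
    have h1 := pow_le_one₀ (n := 2) (sigmoid_nonneg t) (sigmoid_le_one t)
    nlinarith [mul_one_sub_sigmoid_le_one t, sq_nonneg (t * (1 - sigmoid t))]

theorem integral_Ioi_sq_mul_sq_sigmoid_mul_one_sub :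
    ∫ t in Ioi (0 : ℝ), (t * (sigmoid t * (1 - sigmoid t))) ^ 2 = (π ^ 2 - 6) / 36 := by
  have hd (x : ℝ) : HasDerivAt (fun t => (-(t ^ 2 * (1 - sigmoid t))
        - t ^ 2 * (1 - sigmoid t) * (sigmoid t * (1 - 2 * sigmoid t))
        + 2 * (t ^ 1 * (1 - sigmoid t) * sigmoid t) - 2 * sigmoid t) / 6)
      ((x * (sigmoid x * (1 - sigmoid x))) ^ 2 - x * (1 - sigmoid x) / 3) x := by
    have hs := hasDerivAt_sigmoid x
    have h2 := (hasDerivAt_pow 2 x).mul (hs.const_sub 1)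
    have h1 := (hasDerivAt_pow 1 x).mul (hs.const_sub 1)
    refine ((((h2.neg.sub (h2.mul (hs.mul ((hs.const_mul 2).const_sub 1)))).add
      ((h1.mul hs).const_mul 2)).sub (hs.const_mul 2)).div_const 6).congr_deriv ?_
    simp
    ring
  have hs := tendsto_sigmoid_atTop
  have h2 := tendsto_pow_mul_one_sub_sigmoid_atTop 2
  have h1 := tendsto_pow_mul_one_sub_sigmoid_atTop 1
  have hlim := (((h2.neg.sub (h2.mul (hs.mul ((hs.const_mul 2).const_sub 1)))).add
      ((h1.mul hs).const_mul 2)).sub (hs.const_mul 2)).div_const 6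
  have hi := integrableOn_mul_one_sub_sigmoid.div_const 3
  have h := integral_Ioi_of_hasDerivAt_of_tendsto' (fun x _ => hd x)
    (integrableOn_sq_mul_sq_sigmoid_mul_one_sub.sub hi) hlim
  rw [integral_sub integrableOn_sq_mul_sq_sigmoid_mul_one_sub hi, integral_div,
    integral_mul_one_sub_sigmoid, sigmoid_zero] at h
  norm_num at h
  linarith

theorem integral_sq_mul_sq_sigmoid_mul_one_sub :
    ∫ t, (t * (sigmoid t * (1 - sigmoid t))) ^ 2 = (π ^ 2 - 6) / 18 := by
  have h := integral_comp_abs (f := fun t => (t * (sigmoid t * (1 - sigmoid t))) ^ 2)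
  simp only [sigmoid_abs_mul_one_sub, mul_pow _ (_ * _), sq_abs] at h
  simp only [← mul_pow] at h
  rw [h, integral_Ioi_sq_mul_sq_sigmoid_mul_one_sub]
  ring

theorem integrable_sigmoid_mul_one_sub : Integrable fun t => sigmoid t * (1 - sigmoid t) :=
  integrable_of_integral_eq_one integral_sigmoid_mul_one_sub

theorem integrable_sq_sigmoid_mul_one_sub :
    Integrable fun t => (sigmoid t * (1 - sigmoid t)) ^ 2 :=
  .of_integral_ne_zero (by rw [integral_sq_sigmoid_mul_one_sub]; norm_num)

theorem integrable_sq_mul_sq_sigmoid_mul_one_sub :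
    Integrable fun t => (t * (sigmoid t * (1 - sigmoid t))) ^ 2 :=
  .of_integral_ne_zero (by
    rw [integral_sq_mul_sq_sigmoid_mul_one_sub]
    nlinarith [pi_gt_three])

theorem integrable_one_sub_two_mul_sigmoid_mul :
    Integrable fun t => (1 - 2 * sigmoid t) * (sigmoid t * (1 - sigmoid t)) := by
  refine integrable_sigmoid_mul_one_sub.mono' ?_ ?_
  · exact Continuous.aestronglyMeasurable (by fun_prop)
  · refine .of_forall fun t => ?_
    rw [norm_mul, norm_of_nonneg (sigmoid_mul_one_sub_nonneg t)]
    refine mul_le_of_le_one_left (sigmoid_mul_one_sub_nonneg t) (abs_le.mpr ⟨?_, ?_⟩) <;>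
      linarith [sigmoid_le_one t, sigmoid_nonneg t]

end Real

theorem integral_eq_zero_of_forall_neg {f : ℝ → ℝ} (hf : ∀ t, f (-t) = -f t) :
    ∫ t, f t = 0 := by
  have h := integral_neg_eq_self f volume
  simp only [hf, integral_neg] at h
  linarith

section LogLogistic

variable {a s x : ℝ}

theorem llogisPDF_eq (hs : 0 < s) (hx : 0 < x) :
    llogisPDF a s x = a / x * (sigmoid (a * log (x / s)) * (1 - sigmoid (a * log (x / s)))) := by
  rw [llogisPDF, if_pos hx, rpow_def_of_pos (div_pos hx hs), mul_comm (log _), sigmoid_def,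
    exp_neg]
  have := exp_pos (a * log (x / s))
  field_simp
  ring

theorem integral_mul_llogisPDF (ha : 0 < a) (hs : 0 < s) (g : ℝ → ℝ) :
    ∫ x in Ioi (0 : ℝ), g (a * log (x / s)) * llogisPDF a s x
      = ∫ t, g t * (sigmoid t * (1 - sigmoid t)) := by
  have hd : ∀ x ∈ Ioi (0 : ℝ), HasDerivWithinAt (fun x => a * log (x / s)) (a / x) (Ioi 0) x := by
    intro x hx
    have hx : 0 < x := hx
    refine ((((hasDerivAt_id x).div_const s).log (div_pos hx hs).ne').const_mul
      a).hasDerivWithinAt.congr_deriv ?_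
    simp only [id]
    field_simp
  have hmono : MonotoneOn (fun x => a * log (x / s)) (Ioi 0) := by
    intro x hx y _ hxy
    have := log_le_log (div_pos hx hs) (div_le_div_of_nonneg_right hxy hs.le)
    exact mul_le_mul_of_nonneg_left this ha.le
  have himage : (fun x => a * log (x / s)) '' Ioi 0 = univ := by
    refine eq_univ_of_forall fun t => ⟨s * exp (t / a), mul_pos hs (exp_pos _), ?_⟩
    simp only
    rw [mul_div_cancel_left₀ _ hs.ne', log_exp, mul_div_cancel₀ _ ha.ne']
  have h := integral_image_eq_integral_deriv_smul_of_monotoneOn measurableSet_Ioi hd hmono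
    (fun t => g t * (sigmoid t * (1 - sigmoid t)))
  rw [himage, setIntegral_univ] at h
  rw [h]
  refine setIntegral_congr_fun measurableSet_Ioi fun x hx => ?_
  rw [llogisPDF_eq hs hx, smul_eq_mul]
  ring

theorem log_llogisPDF (ha : 0 < a) (hs : 0 < s) (hx : 0 < x) :
    log (llogisPDF a s x) = log a - log x
      + (log (sigmoid (a * log (x / s))) + log (1 - sigmoid (a * log (x / s)))) := by
  have h1 := (sigmoid_pos (a * log (x / s))).ne'
  have h2 := (sub_pos.mpr (sigmoid_lt_one (a * log (x / s)))).ne'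
  rw [llogisPDF_eq hs hx, log_mul (by positivity) (mul_ne_zero h1 h2), log_mul h1 h2,
    log_div ha.ne' hx.ne']

theorem HasDerivAt.log_sigmoid_add_log_one_sub {f : ℝ → ℝ} {f' y : ℝ} (hf : HasDerivAt f f' y) :
    HasDerivAt (fun y => Real.log (Real.sigmoid (f y)) + Real.log (1 - Real.sigmoid (f y)))
      ((1 - 2 * Real.sigmoid (f y)) * f') y := by
  have h1 := (sigmoid_pos (f y)).ne'
  have h2 := (sub_pos.mpr (sigmoid_lt_one (f y))).ne'
  have h := (hasDerivAt_sigmoid (f y)).comp y hf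
  refine ((h.log h1).add ((h.const_sub 1).log h2)).congr_deriv ?_
  simp only [Function.comp_apply]
  field_simp
  ring

theorem HasDerivAt.one_sub_two_mul_sigmoid {f : ℝ → ℝ} {f' y : ℝ} (hf : HasDerivAt f f' y) :
    HasDerivAt (fun y => 1 - 2 * Real.sigmoid (f y))
      (-2 * (Real.sigmoid (f y) * (1 - Real.sigmoid (f y))) * f') y := by
  refine ((((hasDerivAt_sigmoid (f y)).comp y hf).const_mul 2).const_sub 1).congr_deriv ?_
  ring

theorem hasDerivAt_mul_log_div (a : ℝ) (hs : 0 < s) (hx : 0 < x) :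
    HasDerivAt (fun s => a * log (x / s)) (-a / s) s := by
  refine ((((hasDerivAt_inv hs.ne').const_mul x).log
    (mul_pos hx (inv_pos.mpr hs)).ne').const_mul a).congr_deriv ?_
  field_simp

theorem deriv_log_llogisPDF_shape (ha : 0 < a) (hs : 0 < s) (hx : 0 < x) :
    deriv (fun a' => log (llogisPDF a' s x)) a
      = a⁻¹ + (1 - 2 * sigmoid (a * log (x / s))) * log (x / s) := by
  have h := ((hasDerivAt_log ha.ne').sub_const (log x)).add
    (hasDerivAt_mul_const (x := a) (log (x / s))).log_sigmoid_add_log_one_sub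
  refine (h.congr_of_eventuallyEq ?_).deriv
  filter_upwards [lt_mem_nhds ha] with a' ha'
  exact log_llogisPDF ha' hs hx

theorem deriv_log_llogisPDF_scale (ha : 0 < a) (hs : 0 < s) (hx : 0 < x) :
    deriv (fun s' => log (llogisPDF a s' x)) s
      = (1 - 2 * sigmoid (a * log (x / s))) * (-a / s) := by
  have h := (hasDerivAt_mul_log_div a hs hx).log_sigmoid_add_log_one_sub.const_add (log a - log x)
  refine (h.congr_of_eventuallyEq ?_).deriv
  filter_upwards [lt_mem_nhds hs] with s' hs'
  exact log_llogisPDF ha hs' hx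

theorem iteratedDeriv_two_log_llogisPDF_shape (ha : 0 < a) (hs : 0 < s) (hx : 0 < x) :
    iteratedDeriv 2 (fun a' => log (llogisPDF a' s x)) a
      = -(1 / a ^ 2) - 2 * (sigmoid (a * log (x / s)) * (1 - sigmoid (a * log (x / s))))
        * log (x / s) ^ 2 := by
  rw [iteratedDeriv_succ, iteratedDeriv_one]
  have h := (hasDerivAt_inv ha.ne').add
    ((hasDerivAt_mul_const (x := a) (log (x / s))).one_sub_two_mul_sigmoid.mul_const (log (x / s)))
  refine (h.congr_of_eventuallyEq ?_).deriv.trans (by ring)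
  filter_upwards [lt_mem_nhds ha] with a' ha'
  exact deriv_log_llogisPDF_shape ha' hs hx

theorem iteratedDeriv_two_log_llogisPDF_scale (ha : 0 < a) (hs : 0 < s) (hx : 0 < x) :
    iteratedDeriv 2 (fun s' => log (llogisPDF a s' x)) s
      = (a / s ^ 2) * (1 - 2 * sigmoid (a * log (x / s)))
        - 2 * (a / s) ^ 2 * (sigmoid (a * log (x / s)) * (1 - sigmoid (a * log (x / s)))) := by
  rw [iteratedDeriv_succ, iteratedDeriv_one]
  have h := (hasDerivAt_mul_log_div a hs hx).one_sub_two_mul_sigmoid.mul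
    ((hasDerivAt_inv hs.ne').const_mul (-a))
  refine (h.congr_of_eventuallyEq ?_).deriv.trans ?_
  · filter_upwards [lt_mem_nhds hs] with s' hs'
    exact deriv_log_llogisPDF_scale ha hs' hx
  · field_simp
    ring

theorem deriv_deriv_log_llogisPDF (ha : 0 < a) (hs : 0 < s) (hx : 0 < x) :
    deriv (fun a' => deriv (fun s' => log (llogisPDF a' s' x)) s) a
      = -(1 / s) * (1 - 2 * sigmoid (a * log (x / s)))
        + 2 * (a / s) * (sigmoid (a * log (x / s)) * (1 - sigmoid (a * log (x / s))))
          * log (x / s) := by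
  have h := (hasDerivAt_mul_const (x := a) (log (x / s))).one_sub_two_mul_sigmoid.mul
    ((hasDerivAt_id a).neg.div_const s)
  refine (h.congr_of_eventuallyEq ?_).deriv.trans ?_
  · filter_upwards [lt_mem_nhds ha] with a' ha'
    exact deriv_log_llogisPDF_scale ha' hs hx
  · simp only [id, Pi.neg_apply]
    ring

theorem integral_iteratedDeriv_two_shape (ha : 0 < a) (hs : 0 < s) :
    ∫ x in Ioi (0 : ℝ), iteratedDeriv 2 (fun a' => log (llogisPDF a' s x)) a * llogisPDF a s x
      = -((3 + π ^ 2) / (9 * a ^ 2)) := by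
  have hg := integral_mul_llogisPDF ha hs
    fun t => -(1 / a ^ 2) - 2 * (sigmoid t * (1 - sigmoid t)) * (t / a) ^ 2
  have hcongr : ∀ t, (-(1 / a ^ 2) - 2 * (sigmoid t * (1 - sigmoid t)) * (t / a) ^ 2)
      * (sigmoid t * (1 - sigmoid t))
      = -(1 / a ^ 2) * (sigmoid t * (1 - sigmoid t))
        - 2 / a ^ 2 * (t * (sigmoid t * (1 - sigmoid t))) ^ 2 := fun t => by ring
  simp only [hcongr] at hg
  rw [integral_sub (integrable_sigmoid_mul_one_sub.const_mul _)
    (integrable_sq_mul_sq_sigmoid_mul_one_sub.const_mul _), integral_const_mul, integral_const_mul,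
    integral_sigmoid_mul_one_sub, integral_sq_mul_sq_sigmoid_mul_one_sub] at hg
  refine (setIntegral_congr_fun measurableSet_Ioi fun x hx => ?_).trans (hg.trans ?_)
  · rw [iteratedDeriv_two_log_llogisPDF_shape ha hs hx, mul_div_cancel_left₀ _ ha.ne']
  · field_simp
    ring

theorem integral_iteratedDeriv_two_scale (ha : 0 < a) (hs : 0 < s) :
    ∫ x in Ioi (0 : ℝ), iteratedDeriv 2 (fun s' => log (llogisPDF a s' x)) s * llogisPDF a s x
      = -((1 / 3) * (a / s) ^ 2) := by
  have hg := integral_mul_llogisPDF ha hs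
    fun t => (a / s ^ 2) * (1 - 2 * sigmoid t)
      - 2 * (a / s) ^ 2 * (sigmoid t * (1 - sigmoid t))
  have hcongr : ∀ t, ((a / s ^ 2) * (1 - 2 * sigmoid t)
      - 2 * (a / s) ^ 2 * (sigmoid t * (1 - sigmoid t))) * (sigmoid t * (1 - sigmoid t))
      = (a / s ^ 2) * ((1 - 2 * sigmoid t) * (sigmoid t * (1 - sigmoid t)))
        - 2 * (a / s) ^ 2 * (sigmoid t * (1 - sigmoid t)) ^ 2 := fun t => by ring
  simp only [hcongr] at hg
  rw [integral_sub (integrable_one_sub_two_mul_sigmoid_mul.const_mul _)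
    (integrable_sq_sigmoid_mul_one_sub.const_mul _), integral_const_mul, integral_const_mul,
    integral_sq_sigmoid_mul_one_sub, integral_eq_zero_of_forall_neg fun t => by
      rw [sigmoid_neg]; ring] at hg
  refine (setIntegral_congr_fun measurableSet_Ioi fun x hx => ?_).trans (hg.trans ?_)
  · rw [iteratedDeriv_two_log_llogisPDF_scale ha hs hx]
  · ring

theorem integral_deriv_deriv_log_llogisPDF (ha : 0 < a) (hs : 0 < s) :
    ∫ x in Ioi (0 : ℝ),
      deriv (fun a' => deriv (fun s' => log (llogisPDF a' s' x)) s) a * llogisPDF a s x = 0 := by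
  have hg := integral_mul_llogisPDF ha hs
    fun t => -(1 / s) * (1 - 2 * sigmoid t)
      + 2 * (a / s) * (sigmoid t * (1 - sigmoid t)) * (t / a)
  rw [integral_eq_zero_of_forall_neg fun t => by rw [sigmoid_neg]; ring] at hg
  refine (setIntegral_congr_fun measurableSet_Ioi fun x hx => ?_).trans hg
  rw [deriv_deriv_log_llogisPDF ha hs hx, mul_div_cancel_left₀ _ ha.ne']

end LogLogistic

end

/-- The Fisher information matrix of the log-logistic distribution `LL(a, s)`,
computed as the negative expected Hessian of the log-density, is the diagonal matrix
with entries `I₁₁ = (3 + π²)/(9a²)`, `I₂₂ = (1/3)(a/s)²`, `I₁₂ = I₂₁ = 0`;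
in particular it is positive definite. -/
theorem llogis_fisher_information (a s : ℝ) (ha : 0 < a) (hs : 0 < s) :
    (-∫ x in Set.Ioi (0 : ℝ),
        iteratedDeriv 2 (fun a' => Real.log (llogisPDF a' s x)) a * llogisPDF a s x
      = (3 + Real.pi ^ 2) / (9 * a ^ 2)) ∧
    (-∫ x in Set.Ioi (0 : ℝ),
        iteratedDeriv 2 (fun s' => Real.log (llogisPDF a s' x)) s * llogisPDF a s x
      = (1 / 3) * (a / s) ^ 2) ∧
    (-∫ x in Set.Ioi (0 : ℝ),
        deriv (fun a' => deriv (fun s' => Real.log (llogisPDF a' s' x)) s) a * llogisPDF a s x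
      = 0) ∧
    (!![(3 + Real.pi ^ 2) / (9 * a ^ 2), 0; 0, (1 / 3) * (a / s) ^ 2] :
      Matrix (Fin 2) (Fin 2) ℝ).PosDef := by
  refine ⟨?_, ?_, ?_, ?_⟩
  · rw [integral_iteratedDeriv_two_shape ha hs, neg_neg]
  · rw [integral_iteratedDeriv_two_scale ha hs, neg_neg]
  · rw [integral_deriv_deriv_log_llogisPDF ha hs, neg_zero]
  · rw [← Matrix.diagonal_vec2, Matrix.posDef_diagonal_iff, Fin.forall_fin_two]
    constructor <;> simp only [Matrix.cons_val_zero, Matrix.cons_val_one] <;> positivity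
end

section
/- Let X have the generalized Beta distribution of the second kind GB2(a, b, p, q) with a, b, p, q > 0, and let m be a real number with 0 < m < aq. Then the m-th moment of X is finite and equals E[X^m] = b^m · B(p + m/a, q − m/a) / B(p, q). -/
open MeasureTheory Set

/-- The Beta function `B(p, q) = ∫₀¹ t^{p−1}(1−t)^{q−1} dt`. -/
noncomputable def realBeta (p q : ℝ) : ℝ :=
  ∫ t in (0 : ℝ)..1, t ^ (p - 1) * (1 - t) ^ (q - 1)

/-- Density of the generalized Beta distribution of the second kind `GB2(a, b, p, q)`. -/
noncomputable def gb2PDF (a b p q x : ℝ) : ℝ :=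
  if 0 < x then a * (x / b) ^ (a * p - 1) / (b * realBeta p q * (1 + (x / b) ^ a) ^ (p + q))
  else 0

/-- The integrand of the Beta function is integrable on `(0, 1)`. -/
theorem integrableOn_rpow_mul_one_sub_rpow {u v : ℝ} (hu : 0 < u) (hv : 0 < v) :
    IntegrableOn (fun t : ℝ => t ^ (u - 1) * (1 - t) ^ (v - 1)) (Ioo 0 1) := by
  have h := Complex.betaIntegral_convergent (u := (u : ℂ)) (v := (v : ℂ)) (by simpa) (by simpa)
  rw [intervalIntegrable_iff_integrableOn_Ioo_of_le zero_le_one] at h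
  refine IntegrableOn.congr_fun h.norm (fun t ht => ?_) measurableSet_Ioo
  have h1 : 0 < 1 - t := sub_pos.2 ht.2
  have e : (1 - (t : ℂ)) = ((1 - t : ℝ) : ℂ) := by push_cast; rfl
  simp only [norm_mul]
  rw [e, Complex.norm_cpow_eq_rpow_re_of_pos ht.1, Complex.norm_cpow_eq_rpow_re_of_pos h1]
  simp

/-- The Beta function as an integral over `(0, 1)`. -/
theorem realBeta_eq_setIntegral_Ioo (u v : ℝ) :
    realBeta u v = ∫ t in Ioo (0 : ℝ) 1, t ^ (u - 1) * (1 - t) ^ (v - 1) := by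
  rw [realBeta, intervalIntegral.integral_of_le zero_le_one, integral_Ioc_eq_integral_Ioo]

/-- The change of variables carrying the Beta distribution of the second kind to the Beta
distribution on `(0, 1)`. -/
noncomputable def gb2ToUnit (a b x : ℝ) : ℝ := (x / b) ^ a / (1 + (x / b) ^ a)

theorem hasDerivAt_gb2ToUnit {a b x : ℝ} (hb : 0 < b) (hx : 0 < x) :
    HasDerivAt (gb2ToUnit a b)
      (a / b * (x / b) ^ (a - 1) / (1 + (x / b) ^ a) ^ 2) x := by
  have hy : 0 < x / b := div_pos hx hb
  have hpow : HasDerivAt (fun x : ℝ => (x / b) ^ a) (1 / b * a * (x / b) ^ (a - 1)) x :=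
    ((hasDerivAt_id x).div_const b).rpow_const (Or.inl hy.ne')
  have hD : 1 + (x / b) ^ a ≠ 0 := by positivity
  refine (hpow.div (hpow.const_add 1) hD).congr_deriv ?_
  ring

theorem injOn_gb2ToUnit {a b : ℝ} (ha : 0 < a) (hb : 0 < b) :
    InjOn (gb2ToUnit a b) (Ioi 0) := by
  intro x hx y hy h
  have hx' : 0 < x / b := div_pos hx hb
  have hy' : 0 < y / b := div_pos hy hb
  rw [gb2ToUnit, gb2ToUnit, div_eq_div_iff (by positivity) (by positivity)] at h
  have h' : (x / b) ^ a = (y / b) ^ a := by linarith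
  have := (Real.rpow_left_inj hx'.le hy'.le ha.ne').1 h'
  exact (div_left_inj' hb.ne').1 this

theorem image_gb2ToUnit_Ioi {a b : ℝ} (ha : 0 < a) (hb : 0 < b) :
    gb2ToUnit a b '' Ioi 0 = Ioo 0 1 := by
  ext t
  constructor
  · rintro ⟨x, hx, rfl⟩
    have hx' : 0 < x / b := div_pos hx hb
    have hp : 0 < (x / b) ^ a := by positivity
    exact ⟨div_pos hp (by linarith), (div_lt_one (by linarith)).2 (by linarith)⟩
  · rintro ⟨h0, h1⟩
    have h2 : 0 < 1 - t := sub_pos.2 h1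
    refine ⟨b * (t / (1 - t)) ^ a⁻¹, mem_Ioi.2 (by positivity), ?_⟩
    rw [gb2ToUnit, mul_div_cancel_left₀ _ hb.ne', Real.rpow_inv_rpow (by positivity) ha.ne']
    field_simp
    ring

/-- The moment integrand is a multiple of the Beta integrand pulled back along `gb2ToUnit`. -/
theorem rpow_mul_gb2PDF {a b p q m x : ℝ} (ha : 0 < a) (hb : 0 < b) (hx : 0 < x) :
    x ^ m * gb2PDF a b p q x = b ^ m / realBeta p q *
      (|a / b * (x / b) ^ (a - 1) / (1 + (x / b) ^ a) ^ 2| •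
        (gb2ToUnit a b x ^ (p + m / a - 1) * (1 - gb2ToUnit a b x) ^ (q - m / a - 1))) := by
  have hy : 0 < x / b := div_pos hx hb
  have hxy : x = b * (x / b) := by field_simp
  rw [gb2PDF, if_pos hx, gb2ToUnit]
  generalize x / b = y at *
  subst hxy
  have hya : 0 < y ^ a := by positivity
  have hD : 0 < 1 + y ^ a := by linarith
  have h1 : 1 - y ^ a / (1 + y ^ a) = (1 + y ^ a)⁻¹ := by field_simp; ring
  rw [abs_of_pos (by positivity), h1, Real.mul_rpow hb.le hy.le,
    Real.div_rpow hya.le hD.le, ← Real.rpow_mul hy.le, Real.inv_rpow hD.le, smul_eq_mul]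
  have hnum : y ^ m * y ^ (a * p - 1) = y ^ (a - 1) * y ^ (a * (p + m / a - 1)) := by
    rw [← Real.rpow_add hy, ← Real.rpow_add hy]
    congr 1
    field_simp
    ring
  have hden : (1 + y ^ a) ^ (p + q) = (1 + y ^ a) ^ 2 *
      (1 + y ^ a) ^ (p + m / a - 1) * (1 + y ^ a) ^ (q - m / a - 1) := by
    rw [← Real.rpow_natCast, ← Real.rpow_add hD, ← Real.rpow_add hD]
    congr 1
    push_cast
    ring
  calc b ^ m * y ^ m * (a * y ^ (a * p - 1) / (b * realBeta p q * (1 + y ^ a) ^ (p + q)))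
      = b ^ m * a * (y ^ m * y ^ (a * p - 1)) / (b * realBeta p q * (1 + y ^ a) ^ (p + q)) := by
        ring
    _ = _ := by
        rw [hnum, hden]
        simp only [div_eq_mul_inv, mul_inv]
        ring

/-- For `X ~ GB2(a, b, p, q)` with `a, b, p, q > 0` and `0 < m < aq`, the `m`-th moment
of `X` is finite and equals `b^m B(p + m/a, q − m/a) / B(p, q)`. -/
theorem gb2_moment (a b p q m : ℝ) (ha : 0 < a) (hb : 0 < b) (hp : 0 < p) (hq : 0 < q)
    (hm0 : 0 < m) (hmaq : m < a * q) :
    IntegrableOn (fun x => x ^ m * gb2PDF a b p q x) (Set.Ioi 0) volume ∧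
    ∫ x in Set.Ioi (0 : ℝ), x ^ m * gb2PDF a b p q x
      = b ^ m * realBeta (p + m / a) (q - m / a) / realBeta p q := by
  have hu : 0 < p + m / a := by positivity
  have hv : 0 < q - m / a := sub_pos.2 ((div_lt_iff₀' ha).2 hmaq)
  have hderiv : ∀ x ∈ Ioi (0 : ℝ), HasDerivWithinAt (gb2ToUnit a b)
      (a / b * (x / b) ^ (a - 1) / (1 + (x / b) ^ a) ^ 2) (Ioi 0) x :=
    fun x hx => (hasDerivAt_gb2ToUnit hb hx).hasDerivWithinAt
  have hinj := injOn_gb2ToUnit ha hb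
  have heq := fun x (hx : x ∈ Ioi (0 : ℝ)) =>
    rpow_mul_gb2PDF (p := p) (q := q) (m := m) ha hb hx
  constructor
  · rw [integrableOn_congr_fun heq measurableSet_Ioi]
    refine Integrable.const_mul ?_ _
    refine (integrableOn_image_iff_integrableOn_abs_deriv_smul measurableSet_Ioi hderiv hinj
      (fun t : ℝ => t ^ (p + m / a - 1) * (1 - t) ^ (q - m / a - 1))).1 ?_
    rw [image_gb2ToUnit_Ioi ha hb]
    exact integrableOn_rpow_mul_one_sub_rpow hu hv
  · rw [setIntegral_congr_fun measurableSet_Ioi heq, integral_const_mul,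
      ← integral_image_eq_integral_abs_deriv_smul measurableSet_Ioi hderiv hinj
        (fun t : ℝ => t ^ (p + m / a - 1) * (1 - t) ^ (q - m / a - 1)),
      image_gb2ToUnit_Ioi ha hb, ← realBeta_eq_setIntegral_Ioo, div_mul_eq_mul_div]
end
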